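/- Take σ = 1. Let F ⊂ ℝⁿ be a linear subspace of dimension d < n with projection Π, ε₂, ε_∞ > 0, 0 < α < 1, 0 < γ < 1. Define T(Y) = ∑ᵢ (Yᵢ − (ΠY)ᵢ)², let q be the (1−γ)-quantile of the chi-squared distribution with n−d degrees of freedom, and z = Φ⁻¹(1 − α/(4n)). Define the band: if T ≤ q then L = ΠY − (Ω_F·z + ε_∞)·𝟙 and U = ΠY + (Ω_F·z + ε_∞)·𝟙; if T > q then L = Y − z·𝟙 and U = Y + z·𝟙 (𝟙 the all-ones vector). Assume that for every a ∈ ℝ^{n−d} with ∑ₖ aₖ² ≥ n·ε₂², P( ∑ₖ (Zₖ + aₖ)² ≤ q ) ≤ α/2, where Z₁,…,Z_{n−d} are i.i.d. standard normal. Then: (i) for every f ∈ ℝⁿ, P_f( L ≤ f ≤ U or L ≤ f⋆ ≤ U ) ≥ 1 − α; and (ii) for every f ∈ F, P_f( W ≤ 2(Ω_F·z + ε_∞) ) ≥ 1 − γ. -/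

import Mathlib

open MeasureTheory ProbabilityTheory Real

noncomputable section

/-- Product Gaussian measure `N(f, σ² Iₙ)` on `ℝⁿ`. -/
def gaussP (n : ℕ) (f : Fin n → ℝ) (σ : ℝ) : Measure (Fin n → ℝ) :=
  Measure.pi fun i => gaussianReal (f i) (Real.toNNReal (σ ^ 2))

/-- Standard normal CDF `Φ`. -/
def stdCDF (x : ℝ) : ℝ := ((gaussianReal 0 1) (Set.Iic x)).toReal

/-- Standard normal density `φ`. -/
def stdPDF (x : ℝ) : ℝ := Real.exp (-(x ^ 2) / 2) / Real.sqrt (2 * Real.pi)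

/-- `τ(ε) = Φ(ε/2) - Φ(-ε/2)`. -/
def tau (ε : ℝ) : ℝ := stdCDF (ε / 2) - stdCDF (-(ε / 2))

/-- Inverse of `τ`. -/
def tauInv (p : ℝ) : ℝ := Function.invFun tau p

/-- Standard normal quantile function `Φ⁻¹`. -/
def PhiInv (p : ℝ) : ℝ := Function.invFun stdCDF p

/-- Normalized Euclidean norm `‖v‖ = √((1/n) ∑ vᵢ²)`. -/
def norm2 (n : ℕ) (v : Fin n → ℝ) : ℝ := Real.sqrt ((∑ i, (v i) ^ 2) / n)

/-- Sup norm `‖v‖_∞ = maxᵢ |vᵢ|`. -/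
def normInf (n : ℕ) (v : Fin n → ℝ) : ℝ := ⨆ i, |v i|

/-- Normalized inner product. -/
def inner2 (n : ℕ) (u v : Fin n → ℝ) : ℝ := (∑ i, u i * v i) / n

/-- Total variation distance between two measures on `ℝⁿ`. -/
def dTV (n : ℕ) (P Q : Measure (Fin n → ℝ)) : ℝ :=
  ⨆ A : {A : Set (Fin n → ℝ) // MeasurableSet A}, |(P A).toReal - (Q A).toReal|

/-- Width of the band `(L, U)` at data `y`. -/
def width (n : ℕ) (L U : (Fin n → ℝ) → Fin n → ℝ) (y : Fin n → ℝ) : ℝ :=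
  ⨆ i, (U y i - L y i)

/-- The band `(L,U)` covers `g` at data `y`. -/
def covers (n : ℕ) (L U : (Fin n → ℝ) → Fin n → ℝ) (g y : Fin n → ℝ) : Prop :=
  ∀ i, L y i ≤ g i ∧ g i ≤ U y i

/-- `P` is the orthogonal projection onto the subspace `F` of `ℝⁿ`. -/
def IsOrthProjOn (n : ℕ) (F : Submodule ℝ (Fin n → ℝ))
    (P : (Fin n → ℝ) →ₗ[ℝ] (Fin n → ℝ)) : Prop :=
  (∀ f, P f ∈ F) ∧ (∀ f, ∀ g ∈ F, inner2 n (f - P f) g = 0)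

/-- `Ω_F = max_i ‖Π_F eᵢ‖ / ‖eᵢ‖`. -/
def OmegaF (n : ℕ) (P : (Fin n → ℝ) →ₗ[ℝ] (Fin n → ℝ)) : ℝ :=
  ⨆ i : Fin n, norm2 n (P (Pi.single i 1)) / norm2 n (Pi.single i 1)

/-- The `p`-quantile of the chi-squared distribution with `m` degrees of freedom. -/
def chiSqQuantile (m : ℕ) (p : ℝ) : ℝ :=
  sInf {t : ℝ | ENNReal.ofReal p ≤
    (Measure.pi fun _ : Fin m => gaussianReal 0 1) {z | ∑ k, (z k) ^ 2 ≤ t}}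


open Classical in
/-- The surrogate `f⋆`. -/
def surrogate (n : ℕ) (P : (Fin n → ℝ) →ₗ[ℝ] (Fin n → ℝ)) (ε2 εinf : ℝ)
    (f : Fin n → ℝ) : Fin n → ℝ :=
  if norm2 n (f - P f) ≤ ε2 ∧ εinf < normInf n (f - P f) then P f else f

/-- Goodness-of-fit statistic `T(Y) = ∑ᵢ (Yᵢ − (ΠY)ᵢ)²`. -/
def Tstat (n : ℕ) (P : (Fin n → ℝ) →ₗ[ℝ] (Fin n → ℝ)) (y : Fin n → ℝ) : ℝ :=
  ∑ i, (y i - P y i) ^ 2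

/-- `z = Φ⁻¹(1 − α/(4n))`. -/
def zCrit (n : ℕ) (α : ℝ) : ℝ := PhiInv (1 - α / (4 * n))

/-- `c = Ω_F·z + ε_∞`. -/
def cRad (n : ℕ) (P : (Fin n → ℝ) →ₗ[ℝ] (Fin n → ℝ)) (α εinf : ℝ) : ℝ :=
  OmegaF n P * zCrit n α + εinf

open Classical in
/-- Lower band: `ΠY − c·𝟙` if `T ≤ q`, else `Y − z·𝟙`. -/
def bandL (n : ℕ) (P : (Fin n → ℝ) →ₗ[ℝ] (Fin n → ℝ)) (q α εinf : ℝ)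
    (y : Fin n → ℝ) : Fin n → ℝ :=
  fun i => if Tstat n P y ≤ q then P y i - cRad n P α εinf else y i - zCrit n α

open Classical in
/-- Upper band: `ΠY + c·𝟙` if `T ≤ q`, else `Y + z·𝟙`. -/
def bandU (n : ℕ) (P : (Fin n → ℝ) →ₗ[ℝ] (Fin n → ℝ)) (q α εinf : ℝ)
    (y : Fin n → ℝ) : Fin n → ℝ :=
  fun i => if Tstat n P y ≤ q then P y i + cRad n P α εinf else y i + zCrit n α

/-- A family of linear functionals with orthonormal coefficient vectors maps a standard Gaussian
vector to a standard Gaussian vector. -/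
theorem map_orthonormal_pi_gaussianReal {ι κ : Type*} [Fintype ι] [Fintype κ] [DecidableEq κ]
    (b : κ → ι → ℝ) (hb : ∀ k l, ∑ i, b k i * b l i = if k = l then 1 else 0) :
    (Measure.pi fun _ : ι => gaussianReal 0 1).map (fun y k => ∑ i, b k i * y i) =
      Measure.pi fun _ : κ => gaussianReal 0 1 := by
  rw [← charFun_eq_pi_iff]
  intro t
  have hm : Measurable fun (y : ι → ℝ) (k : κ) => ∑ i, b k i * y i := by fun_prop
  rw [Measure.map_map (by fun_prop) hm, charFun_apply,
    integral_map ((by fun_prop : Measurable (WithLp.toLp 2 : (κ → ℝ) → _)).comp hm).aemeasurable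
      (by fun_prop)]
  have key := charFun_pi (μ := fun _ : ι => gaussianReal 0 1)
    (WithLp.toLp 2 fun i => ∑ k, b k i * t k)
  rw [charFun_apply, integral_map (by fun_prop) (by fun_prop)] at key
  have hinner : ∀ y : ι → ℝ,
      inner ℝ (((WithLp.toLp 2) ∘ fun (y : ι → ℝ) (k : κ) => ∑ i, b k i * y i) y) t =
        inner ℝ (WithLp.toLp 2 y) (WithLp.toLp 2 fun i => ∑ k, b k i * t k) := by
    intro y
    simp only [Function.comp, PiLp.inner_apply, RCLike.inner_apply, conj_trivial, Finset.mul_sum,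
      Finset.sum_mul]
    rw [Finset.sum_comm]
    exact Finset.sum_congr rfl fun i _ => Finset.sum_congr rfl fun k _ => by ring
  simp_rw [hinner]
  rw [key]
  simp_rw [charFun_gaussianReal, ← Complex.exp_sum]
  congr 1
  have hsq : ∑ i, (∑ k, b k i * t k) ^ 2 = ∑ k, t k ^ 2 := by
    have h1 : ∀ i, (∑ k, b k i * t k) ^ 2 = ∑ k, ∑ l, (b k i * b l i) * (t k * t l) := by
      intro i
      rw [sq, Finset.sum_mul_sum]
      exact Finset.sum_congr rfl fun k _ => Finset.sum_congr rfl fun l _ => by ring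
    simp_rw [h1]
    rw [Finset.sum_comm]
    refine Finset.sum_congr rfl fun k _ => ?_
    rw [Finset.sum_comm]
    simp_rw [← Finset.sum_mul, hb]
    simp [sq]
  have hC := congrArg (fun x : ℝ => (x : ℂ)) hsq
  push_cast at hC
  simp only [Complex.ofReal_zero, mul_zero, zero_mul, zero_sub, NNReal.coe_one, Complex.ofReal_one,
    one_mul, Finset.sum_neg_distrib, ← Finset.sum_div, Complex.ofReal_sum, Complex.ofReal_mul, hC]

/-- The generalized inverse of a distribution function attains its level. -/
theorem ofReal_le_measure_Iic_sInf (ν : Measure ℝ) [IsProbabilityMeasure ν] {p : ℝ}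
    (hp0 : 0 < p) (hp1 : p < 1) :
    ENNReal.ofReal p ≤ ν (Set.Iic (sInf {t : ℝ | ENNReal.ofReal p ≤ ν (Set.Iic t)})) := by
  have hiff : ∀ t, ENNReal.ofReal p ≤ ν (Set.Iic t) ↔ p ≤ cdf ν t := fun t => by
    rw [← ofReal_cdf, ENNReal.ofReal_le_ofReal_iff (cdf_nonneg ν t)]
  simp_rw [hiff]
  set S := {t : ℝ | p ≤ cdf ν t} with hS
  have hne : S.Nonempty := by
    obtain ⟨t, ht⟩ := ((tendsto_cdf_atTop ν).eventually (lt_mem_nhds hp1)).exists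
    exact ⟨t, ht.le⟩
  have hbdd : BddBelow S := by
    obtain ⟨t, ht⟩ := ((tendsto_cdf_atBot ν).eventually (gt_mem_nhds hp0)).exists
    refine ⟨t, fun s hs => ?_⟩
    by_contra! h
    exact absurd (hs.trans (monotone_cdf ν h.le)) (not_le.2 ht)
  have hr : Filter.Tendsto (cdf ν) (nhdsWithin (sInf S) (Set.Ioi (sInf S)))
      (nhds (cdf ν (sInf S))) :=
    ((cdf ν).right_continuous (sInf S)).mono_left (nhdsWithin_mono _ Set.Ioi_subset_Ici_self)
  refine ge_of_tendsto hr ?_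
  filter_upwards [self_mem_nhdsWithin] with t ht
  obtain ⟨s, hs, hst⟩ := exists_lt_of_csInf_lt hne ht
  exact hs.trans (monotone_cdf ν hst.le)

theorem continuous_stdCDF : Continuous stdCDF := by
  have hcdf : stdCDF = cdf (gaussianReal 0 1) := funext fun x => (cdf_eq_real _ x).symm
  rw [hcdf, continuous_iff_continuousAt]
  intro x
  rw [(monotone_cdf _).continuousAt_iff_leftLim_eq_rightLim, StieltjesFunction.rightLim_eq]
  have := nullSingletonClass_gaussianReal (μ := 0) (v := 1) one_ne_zero
  have h : (cdf (gaussianReal 0 1)).measure {x} = 0 := by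
    rw [measure_cdf]
    exact measure_singleton x
  rw [StieltjesFunction.measure_singleton, ENNReal.ofReal_eq_zero] at h
  exact le_antisymm ((monotone_cdf _).leftLim_le le_rfl) (by linarith)

theorem stdCDF_PhiInv {p : ℝ} (hp0 : 0 < p) (hp1 : p < 1) : stdCDF (PhiInv p) = p := by
  refine Function.invFun_eq ?_
  have hcdf : stdCDF = cdf (gaussianReal 0 1) := funext fun x => (cdf_eq_real _ x).symm
  obtain ⟨s, hs⟩ :=
    ((tendsto_cdf_atBot (gaussianReal 0 1)).eventually (gt_mem_nhds hp0)).exists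
  obtain ⟨t, ht⟩ :=
    ((tendsto_cdf_atTop (gaussianReal 0 1)).eventually (lt_mem_nhds hp1)).exists
  exact mem_range_of_exists_le_of_exists_ge continuous_stdCDF ⟨s, by rw [hcdf]; exact hs.le⟩
    ⟨t, by rw [hcdf]; exact ht.le⟩

theorem gaussianReal_abs_gt_le {z β : ℝ} (hz : stdCDF z = 1 - β) :
    gaussianReal 0 1 {x | z < |x|} ≤ ENNReal.ofReal (2 * β) := by
  have h1 : (gaussianReal 0 1).real (Set.Ioi z) = β := by
    rw [← Set.compl_Iic, probReal_compl_eq_one_sub measurableSet_Iic]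
    change 1 - stdCDF z = β
    linarith
  have hβ : 0 ≤ β := h1 ▸ measureReal_nonneg
  have h1' : gaussianReal 0 1 (Set.Ioi z) = ENNReal.ofReal β := by
    rw [← h1, ofReal_measureReal]
  have h2 : gaussianReal 0 1 (Set.Iio (-z)) = ENNReal.ofReal β := by
    rw [← h1']
    have hneg := gaussianReal_map_neg (μ := 0) (v := 1)
    rw [neg_zero] at hneg
    conv_lhs => rw [← hneg]
    rw [Measure.map_apply measurable_neg measurableSet_Iio]
    congr 1
    ext x
    simp
  calc gaussianReal 0 1 {x | z < |x|} ≤ gaussianReal 0 1 (Set.Ioi z ∪ Set.Iio (-z)) := by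
        refine measure_mono fun x hx => ?_
        rcases lt_abs.1 (show z < |x| from hx) with h | h
        · exact Or.inl h
        · exact Or.inr (show x < -z by linarith)
    _ ≤ _ := measure_union_le _ _
    _ = ENNReal.ofReal (2 * β) := by
        rw [h1', h2, ← ENNReal.ofReal_add hβ hβ, two_mul]

theorem nonneg_of_stdCDF_eq {z β : ℝ} (hz : stdCDF z = 1 - β) (hβ : β < 1 / 2) : 0 ≤ z := by
  by_contra! h
  have h1 := gaussianReal_abs_gt_le hz
  have h2 : {x : ℝ | z < |x|} = Set.univ :=
    Set.eq_univ_of_forall fun x => h.trans_le (abs_nonneg x)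
  rw [h2, measure_univ, ENNReal.one_le_ofReal] at h1
  linarith

theorem gaussP_eq_map (n : ℕ) (f : Fin n → ℝ) :
    gaussP n f 1 = (Measure.pi fun _ : Fin n => gaussianReal 0 1).map (fun x => f + x) := by
  have h := measurePreserving_pi (fun _ : Fin n => gaussianReal 0 1)
    (fun i => gaussianReal (f i) (Real.toNNReal (1 ^ 2))) (f := fun i x => f i + x)
    (fun i => ⟨by fun_prop, by simp [gaussianReal_map_const_add]⟩)
  exact h.map_eq.symm

instance isProbabilityMeasure_gaussP (n : ℕ) (f : Fin n → ℝ) (σ : ℝ) :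
    IsProbabilityMeasure (gaussP n f σ) := by
  unfold gaussP
  infer_instance

/-- Tail bound for a linear functional of a standard Gaussian vector. -/
theorem pi_gaussianReal_abs_sum_gt_le {ι : Type*} [Fintype ι] {c : ι → ℝ} {ω z β : ℝ}
    (hc : √(∑ i, c i ^ 2) ≤ ω) (hz0 : 0 ≤ z) (hz : stdCDF z = 1 - β) :
    (Measure.pi fun _ : ι => gaussianReal 0 1) {x | ω * z < |∑ i, c i * x i|} ≤
      ENNReal.ofReal (2 * β) := by
  set s := √(∑ i, c i ^ 2) with hs
  have hs0 : 0 ≤ s := Real.sqrt_nonneg _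
  have hs2 : s ^ 2 = ∑ i, c i ^ 2 := Real.sq_sqrt (Finset.sum_nonneg fun i _ => sq_nonneg _)
  rcases hs0.eq_or_lt with h0 | hpos
  · have hci : ∀ i, c i = 0 := fun i => by
      rw [← h0, sq, zero_mul, eq_comm, Finset.sum_eq_zero_iff_of_nonneg fun i _ => sq_nonneg _]
        at hs2
      exact pow_eq_zero_iff two_ne_zero |>.1 (hs2 i (Finset.mem_univ i))
    have : {x : ι → ℝ | ω * z < |∑ i, c i * x i|} = ∅ := by
      ext x
      simp [hci, mul_nonneg (h0.symm ▸ hc : (0 : ℝ) ≤ ω) hz0]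
    simp [this]
  · have hmap := map_orthonormal_pi_gaussianReal (fun (_ : Unit) i => c i / s) (fun _ _ => by
      have : ∀ i, c i / s * (c i / s) = c i ^ 2 / s ^ 2 := fun i => by ring
      simp_rw [this, ← Finset.sum_div, ← hs2]
      simp [hpos.ne'])
    have heval := (measurePreserving_eval (fun _ : Unit => gaussianReal 0 1) ()).map_eq
    rw [← hmap, Measure.map_map (by fun_prop) (by fun_prop)] at heval
    have htail := gaussianReal_abs_gt_le hz
    rw [← heval, Measure.map_apply (by fun_prop)
      (measurableSet_lt (by fun_prop) (by fun_prop))] at htail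
    refine (measure_mono fun x hx => ?_).trans htail
    have hx' : ω * z < |∑ i, c i * x i| := hx
    change z < |∑ i, c i / s * x i|
    have : ∑ i, c i / s * x i = (∑ i, c i * x i) / s := by
      rw [Finset.sum_div]
      exact Finset.sum_congr rfl fun i _ => by ring
    rw [this, abs_div, abs_of_pos hpos, lt_div_iff₀ hpos]
    nlinarith [mul_le_mul_of_nonneg_right hc hz0]

section Projection

variable {n : ℕ} {F : Submodule ℝ (Fin n → ℝ)} {P : (Fin n → ℝ) →ₗ[ℝ] (Fin n → ℝ)}

theorem IsOrthProjOn.sum_sub_mul_eq_zero (hn : 0 < n) (hP : IsOrthProjOn n F P)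
    (f : Fin n → ℝ) {g : Fin n → ℝ} (hg : g ∈ F) : ∑ i, (f i - P f i) * g i = 0 := by
  have h := hP.2 f g hg
  unfold inner2 at h
  have hn' : (n : ℝ) ≠ 0 := by positivity
  simpa [hn'] using h

theorem IsOrthProjOn.apply_eq_sum (hn : 0 < n) (hP : IsOrthProjOn n F P)
    (x : Fin n → ℝ) (i : Fin n) : P x i = ∑ j, P (Pi.single i 1) j * x j := by
  have h1 := hP.sum_sub_mul_eq_zero hn x (hP.1 (Pi.single i 1))
  have h2 := hP.sum_sub_mul_eq_zero hn (Pi.single i 1) (hP.1 x)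
  simp only [sub_mul, Finset.sum_sub_distrib] at h1 h2
  have h3 : ∑ j, (Pi.single i 1 : Fin n → ℝ) j * P x j = P x i := by
    simp [Pi.single_apply]
  rw [h3] at h2
  have h4 : ∑ j, P x j * P (Pi.single i 1) j = ∑ j, P (Pi.single i 1) j * P x j :=
    Finset.sum_congr rfl fun j _ => mul_comm _ _
  have h5 : ∑ j, x j * P (Pi.single i 1) j = ∑ j, P (Pi.single i 1) j * x j :=
    Finset.sum_congr rfl fun j _ => mul_comm _ _
  linarith

theorem sqrt_sum_sq_le_OmegaF (hn : 0 < n) (P : (Fin n → ℝ) →ₗ[ℝ] (Fin n → ℝ)) (i : Fin n) :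
    √(∑ j, P (Pi.single i 1) j ^ 2) ≤ OmegaF n P := by
  have h : norm2 n (P (Pi.single i 1)) / norm2 n (Pi.single i 1) =
      √(∑ j, P (Pi.single i 1) j ^ 2) := by
    have hn' : √(n : ℝ) ≠ 0 := by positivity
    have h1 : ∑ j, (Pi.single i 1 : Fin n → ℝ) j ^ 2 = 1 := by simp [Pi.single_apply]
    unfold norm2
    rw [h1, Real.sqrt_div' _ (Nat.cast_nonneg n), Real.sqrt_div' _ (Nat.cast_nonneg n),
      Real.sqrt_one]
    field_simp
  rw [← h]
  exact le_ciSup (f := fun i : Fin n => norm2 n (P (Pi.single i 1)) / norm2 n (Pi.single i 1))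
    (Set.finite_range _).bddAbove i

theorem IsOrthProjOn.exists_orthonormal_Tstat (hn : 0 < n) (hP : IsOrthProjOn n F P) :
    ∃ b : Fin (n - Module.finrank ℝ F) → Fin n → ℝ,
      (∀ k l, ∑ i, b k i * b l i = if k = l then 1 else 0) ∧
      ∀ y, Tstat n P y = ∑ k, (∑ i, b k i * y i) ^ 2 := by
  set e := (WithLp.linearEquiv 2 ℝ (Fin n → ℝ)).symm with he
  set F' : Submodule ℝ (EuclideanSpace ℝ (Fin n)) := F.map e.toLinearMap with hF'
  have hrank : Module.finrank ℝ F'ᗮ = n - Module.finrank ℝ F := by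
    have h1 := Submodule.finrank_add_finrank_orthogonal F'
    have h2 : Module.finrank ℝ F' = Module.finrank ℝ F := LinearEquiv.finrank_map_eq e F
    rw [finrank_euclideanSpace_fin] at h1
    omega
  let B := (stdOrthonormalBasis ℝ F'ᗮ).reindex (finCongr hrank)
  refine ⟨fun k i => (B k : EuclideanSpace ℝ (Fin n)) i, fun k l => ?_, fun y => ?_⟩
  · have h := orthonormal_iff_ite.1 B.orthonormal k l
    rw [Submodule.coe_inner, PiLp.inner_apply] at h
    rw [← h]
    exact Finset.sum_congr rfl fun i _ => by simp [mul_comm]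
  · have hr : e (y - P y) ∈ F'ᗮ := by
      rw [Submodule.mem_orthogonal']
      rintro _ ⟨g, hg, rfl⟩
      rw [PiLp.inner_apply, ← hP.sum_sub_mul_eq_zero hn y hg]
      exact Finset.sum_congr rfl fun i _ => by simp [he, mul_comm]
    have h := B.sum_sq_norm_inner_right ⟨e (y - P y), hr⟩
    have hk : ∀ k, inner ℝ (B k) (⟨e (y - P y), hr⟩ : F'ᗮ) =
        ∑ i, (B k : EuclideanSpace ℝ (Fin n)) i * y i := by
      intro k
      have h0 : inner ℝ (B k : EuclideanSpace ℝ (Fin n)) (e (P y)) = 0 :=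
        (Submodule.mem_orthogonal' _ _).1 (B k).2 _ ⟨P y, hP.1 y, rfl⟩
      rw [Submodule.coe_inner]
      change inner ℝ (B k : EuclideanSpace ℝ (Fin n)) (e (y - P y)) = _
      rw [map_sub, inner_sub_right, h0, sub_zero, PiLp.inner_apply]
      exact Finset.sum_congr rfl fun i _ => by simp [he, mul_comm]
    simp_rw [hk, Real.norm_eq_abs, sq_abs] at h
    rw [h, Submodule.coe_norm, EuclideanSpace.norm_sq_eq]
    exact Finset.sum_congr rfl fun i _ => by simp [he]

end Projection

section Band

variable {n : ℕ} {F : Submodule ℝ (Fin n → ℝ)} {P : (Fin n → ℝ) →ₗ[ℝ] (Fin n → ℝ)}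

/-- Under `N(f, Iₙ)`, the statistic `T` is noncentral chi-squared with noncentrality `T(f)`. -/
theorem IsOrthProjOn.exists_gaussP_Tstat_le (hn : 0 < n) (hP : IsOrthProjOn n F P)
    (f : Fin n → ℝ) :
    ∃ a : Fin (n - Module.finrank ℝ F) → ℝ, ∑ k, a k ^ 2 = Tstat n P f ∧
      ∀ q, gaussP n f 1 {y | Tstat n P y ≤ q} =
        (Measure.pi fun _ : Fin (n - Module.finrank ℝ F) => gaussianReal 0 1)
          {z | ∑ k, (z k + a k) ^ 2 ≤ q} := by
  obtain ⟨b, hb, hT⟩ := hP.exists_orthonormal_Tstat hn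
  refine ⟨fun k => ∑ i, b k i * f i, (hT f).symm, fun q => ?_⟩
  have hm : MeasurableSet {y : Fin n → ℝ | Tstat n P y ≤ q} := by
    simp_rw [hT]
    exact measurableSet_le (by fun_prop) (by fun_prop)
  rw [gaussP_eq_map, Measure.map_apply (by fun_prop) hm, ← map_orthonormal_pi_gaussianReal b hb,
    Measure.map_apply (by fun_prop) (measurableSet_le (by fun_prop) (by fun_prop))]
  congr 1
  ext x
  simp only [Set.mem_preimage, Set.mem_ofPred_eq, hT, Pi.add_apply, mul_add,
    Finset.sum_add_distrib, add_comm]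

theorem Tstat_eq_mul_norm2_sq (hn : 0 < n) (f : Fin n → ℝ) :
    Tstat n P f = n * norm2 n (f - P f) ^ 2 := by
  have hn' : (n : ℝ) ≠ 0 := by positivity
  unfold Tstat norm2
  rw [Real.sq_sqrt (by positivity)]
  field_simp
  simp

theorem abs_le_normInf (v : Fin n → ℝ) (i : Fin n) : |v i| ≤ normInf n v :=
  le_ciSup (f := fun i => |v i|) (Set.finite_range _).bddAbove i

theorem zCrit_spec (hn : 0 < n) {α : ℝ} (hα : 0 < α) (hα1 : α < 1) :
    stdCDF (zCrit n α) = 1 - α / (4 * n) ∧ 0 ≤ zCrit n α := by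
  have hn' : (1 : ℝ) ≤ n := by exact_mod_cast hn
  have h0 : 0 < α / (4 * n) := by positivity
  have h1 : α / (4 * n) < 1 / 2 := by
    rw [div_lt_iff₀ (by positivity)]
    linarith
  have h : stdCDF (zCrit n α) = 1 - α / (4 * n) := stdCDF_PhiInv (by linarith) (by linarith)
  exact ⟨h, nonneg_of_stdCDF_eq h h1⟩

/-- Union bound for finitely many linear functionals of the Gaussian noise. -/
theorem gaussP_exists_abs_sum_gt_le (hn : 0 < n) {α : ℝ} (hα : 0 < α) (hα1 : α < 1)
    (f : Fin n → ℝ) (c : Fin n → Fin n → ℝ) {ω : ℝ} (hc : ∀ i, √(∑ j, c i j ^ 2) ≤ ω) :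
    gaussP n f 1 {y | ∃ i, ω * zCrit n α < |∑ j, c i j * (y j - f j)|} ≤
      ENNReal.ofReal (α / 2) := by
  obtain ⟨hz, hz0⟩ := zCrit_spec hn hα hα1
  have hn' : (n : ℝ) ≠ 0 := by positivity
  rw [Set.ofPred_exists]
  calc _ ≤ ∑ i, gaussP n f 1 {y | ω * zCrit n α < |∑ j, c i j * (y j - f j)|} :=
        measure_iUnion_fintype_le _ _
    _ ≤ ∑ _i : Fin n, ENNReal.ofReal (2 * (α / (4 * n))) := by
        refine Finset.sum_le_sum fun i _ => ?_
        rw [gaussP_eq_map, Measure.map_apply (by fun_prop)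
          (measurableSet_lt (by fun_prop) (by fun_prop))]
        simpa using pi_gaussianReal_abs_sum_gt_le (hc i) hz0 hz
    _ = ENNReal.ofReal (α / 2) := by
        rw [Finset.sum_const, Finset.card_univ, Fintype.card_fin, nsmul_eq_mul,
          ← ENNReal.ofReal_natCast, ← ENNReal.ofReal_mul (by positivity)]
        congr 1
        field_simp
        norm_num

theorem gaussP_exists_noise_gt_le (hn : 0 < n) {α : ℝ} (hα : 0 < α) (hα1 : α < 1)
    (f : Fin n → ℝ) :
    gaussP n f 1 {y | ∃ i, zCrit n α < |y i - f i|} ≤ ENNReal.ofReal (α / 2) := by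
  have h := gaussP_exists_abs_sum_gt_le hn hα hα1 f (fun i => Pi.single i 1) (ω := 1)
    (fun i => by simp [Pi.single_apply])
  simpa [Pi.single_apply] using h

theorem IsOrthProjOn.gaussP_exists_proj_noise_gt_le (hn : 0 < n) (hP : IsOrthProjOn n F P)
    {α : ℝ} (hα : 0 < α) (hα1 : α < 1) (f : Fin n → ℝ) :
    gaussP n f 1 {y | ∃ i, OmegaF n P * zCrit n α < |P y i - P f i|} ≤
      ENNReal.ofReal (α / 2) := by
  have h := gaussP_exists_abs_sum_gt_le hn hα hα1 f (fun i => P (Pi.single i 1))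
    (sqrt_sum_sq_le_OmegaF hn P)
  have heq : ∀ (y : Fin n → ℝ) i,
      ∑ j, P (Pi.single i 1) j * (y j - f j) = P y i - P f i := fun y i => by
    rw [← Pi.sub_apply (P y), ← map_sub, hP.apply_eq_sum hn]
    rfl
  simpa only [heq] using h

theorem covers_of_lt_Tstat {q α εinf : ℝ} {g y : Fin n → ℝ} (hT : q < Tstat n P y)
    (h : ∀ i, |y i - g i| ≤ zCrit n α) :
    covers n (bandL n P q α εinf) (bandU n P q α εinf) g y := by
  intro i
  have hi := abs_le.1 (h i)
  simp only [bandL, bandU, if_neg hT.not_ge]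
  constructor <;> linarith

theorem covers_of_Tstat_le {q α εinf : ℝ} {g y : Fin n → ℝ} (hT : Tstat n P y ≤ q)
    (h : ∀ i, |P y i - g i| ≤ cRad n P α εinf) :
    covers n (bandL n P q α εinf) (bandU n P q α εinf) g y := by
  intro i
  have hi := abs_le.1 (h i)
  simp only [bandL, bandU, if_pos hT]
  constructor <;> linarith

/-- When `f` is close to its projection and the projected noise is small, the band around `ΠY`
covers `f` or its surrogate. -/
theorem covers_or_covers_surrogate {q α ε2 εinf : ℝ} (hεinf : 0 < εinf) {f y : Fin n → ℝ}
    (hf : norm2 n (f - P f) ≤ ε2) (hT : Tstat n P y ≤ q)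
    (h : ∀ i, |P y i - P f i| ≤ OmegaF n P * zCrit n α) :
    covers n (bandL n P q α εinf) (bandU n P q α εinf) f y ∨
      covers n (bandL n P q α εinf) (bandU n P q α εinf) (surrogate n P ε2 εinf f) y := by
  by_cases hinf : εinf < normInf n (f - P f)
  · right
    rw [surrogate, if_pos ⟨hf, hinf⟩]
    refine covers_of_Tstat_le hT fun i => ?_
    unfold cRad
    linarith [h i]
  · left
    refine covers_of_Tstat_le hT fun i => ?_
    have h1 := abs_le_normInf (f - P f) i
    rw [Pi.sub_apply, abs_sub_comm] at h1
    have h2 := abs_sub_le (P y i) (P f i) (f i)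
    unfold cRad
    linarith [h i, not_lt.1 hinf]

theorem ofReal_one_sub_le_measure {Ω : Type*} [MeasurableSpace Ω] (μ : Measure Ω)
    [IsProbabilityMeasure μ] {α : ℝ} (hα : 0 ≤ α) {s t u : Set Ω} (hs : sᶜ ⊆ t ∪ u)
    (ht : μ t ≤ ENNReal.ofReal (α / 2)) (hu : μ u ≤ ENNReal.ofReal (α / 2)) :
    ENNReal.ofReal (1 - α) ≤ μ s := by
  have h1 : μ sᶜ ≤ ENNReal.ofReal α := by
    refine (measure_mono hs).trans ((measure_union_le _ _).trans ((add_le_add ht hu).trans ?_))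
    rw [← ENNReal.ofReal_add (by positivity) (by positivity), add_halves]
  rw [ENNReal.ofReal_sub _ hα, ENNReal.ofReal_one, tsub_le_iff_right, ← measure_univ (μ := μ)]
  exact (measure_univ_le_add_compl s).trans (by gcongr)

theorem ofReal_le_pi_gaussianReal_chiSqQuantile (m : ℕ) {p : ℝ} (hp0 : 0 < p) (hp1 : p < 1) :
    ENNReal.ofReal p ≤ (Measure.pi fun _ : Fin m => gaussianReal 0 1)
      {z | ∑ k, z k ^ 2 ≤ chiSqQuantile m p} := by
  have hm : Measurable fun z : Fin m → ℝ => ∑ k, z k ^ 2 := by fun_prop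
  have := Measure.isProbabilityMeasure_map (μ := Measure.pi fun _ : Fin m => gaussianReal 0 1)
    hm.aemeasurable
  have h := ofReal_le_measure_Iic_sInf
    ((Measure.pi fun _ : Fin m => gaussianReal 0 1).map fun z => ∑ k, z k ^ 2) hp0 hp1
  simp_rw [Measure.map_apply hm measurableSet_Iic] at h
  exact h

theorem width_le_of_Tstat_le (hn : 0 < n) {q α εinf : ℝ} {y : Fin n → ℝ}
    (hT : Tstat n P y ≤ q) :
    width n (bandL n P q α εinf) (bandU n P q α εinf) y ≤ 2 * cRad n P α εinf := by
  have : Nonempty (Fin n) := ⟨⟨0, hn⟩⟩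
  refine ciSup_le fun i => ?_
  simp only [bandL, bandU, if_pos hT]
  linarith

end Band

/-- the pretesting band achieves valid surrogate coverage and
attains width `2(Ω_F·z + ε_∞)` with probability at least `1−γ` on `F` (σ = 1). -/
theorem surrogate_band_achievability (n d : ℕ) (hd : d < n)
    (F : Submodule ℝ (Fin n → ℝ)) (hdim : Module.finrank ℝ F = d)
    (P : (Fin n → ℝ) →ₗ[ℝ] (Fin n → ℝ)) (hP : IsOrthProjOn n F P)
    (ε2 εinf : ℝ) (hε2 : 0 < ε2) (hεinf : 0 < εinf)
    (α γ : ℝ) (hα : 0 < α) (hα1 : α < 1) (hγ : 0 < γ) (hγ1 : γ < 1)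
    (q : ℝ) (hq : q = chiSqQuantile (n - d) (1 - γ))
    (hnc : ∀ a : Fin (n - d) → ℝ, (n : ℝ) * ε2 ^ 2 ≤ ∑ k, (a k) ^ 2 →
      ((Measure.pi fun _ : Fin (n - d) => gaussianReal 0 1)
        {z | ∑ k, (z k + a k) ^ 2 ≤ q}).toReal ≤ α / 2) :
    (∀ f : Fin n → ℝ,
      ENNReal.ofReal (1 - α) ≤ gaussP n f 1
        {y | covers n (bandL n P q α εinf) (bandU n P q α εinf) f y ∨
             covers n (bandL n P q α εinf) (bandU n P q α εinf)
               (surrogate n P ε2 εinf f) y}) ∧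
    (∀ f ∈ F,
      ENNReal.ofReal (1 - γ) ≤ gaussP n f 1
        {y | width n (bandL n P q α εinf) (bandU n P q α εinf) y ≤
              2 * cRad n P α εinf}) := by
  have hn : 0 < n := (Nat.zero_le d).trans_lt hd
  subst hdim
  refine ⟨fun f => ?_, fun f hf => ?_⟩
  · have hnoise := gaussP_exists_noise_gt_le hn hα hα1 f
    by_cases hfε : norm2 n (f - P f) ≤ ε2
    · refine ofReal_one_sub_le_measure _ hα.le (fun y hy => ?_) hnoise
        (hP.gaussP_exists_proj_noise_gt_le hn hα hα1 f)
      by_contra hbad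
      simp only [Set.mem_union, Set.mem_ofPred_eq, not_or, not_exists, not_lt] at hbad
      refine hy ?_
      rcases le_or_gt (Tstat n P y) q with hT | hT
      · exact covers_or_covers_surrogate hεinf hfε hT hbad.2
      · exact Or.inl (covers_of_lt_Tstat hT hbad.1)
    · obtain ⟨a, ha, hlaw⟩ := hP.exists_gaussP_Tstat_le hn f
      have hpow : gaussP n f 1 {y | Tstat n P y ≤ q} ≤ ENNReal.ofReal (α / 2) := by
        rw [hlaw q]
        refine (ENNReal.le_ofReal_iff_toReal_le (measure_ne_top _ _) (by positivity)).2
          (hnc a ?_)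
        rw [ha, Tstat_eq_mul_norm2_sq hn]
        gcongr
        exact (not_le.1 hfε).le
      refine ofReal_one_sub_le_measure _ hα.le (fun y hy => ?_) hnoise hpow
      by_contra hbad
      simp only [Set.mem_union, Set.mem_ofPred_eq, not_or, not_exists, not_lt, not_le] at hbad
      exact hy (Or.inl (covers_of_lt_Tstat hbad.2 hbad.1))
  · obtain ⟨a, ha, hlaw⟩ := hP.exists_gaussP_Tstat_le hn f
    have hT0 : Tstat n P f = 0 := by
      have h := hP.sum_sub_mul_eq_zero hn f (F.sub_mem hf (hP.1 f))
      simpa [Tstat, sq] using h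
    have ha0 : ∀ k, a k = 0 := fun k => by
      rw [hT0, Finset.sum_eq_zero_iff_of_nonneg fun i _ => sq_nonneg _] at ha
      exact pow_eq_zero_iff two_ne_zero |>.1 (ha k (Finset.mem_univ k))
    have hlaw' := hlaw q
    simp only [ha0, add_zero] at hlaw'
    refine le_trans ?_ (measure_mono (s := {y | Tstat n P y ≤ q}) fun y hy => width_le_of_Tstat_le hn hy)
    rw [hlaw', hq]
    exact ofReal_le_pi_gaussianReal_chiSqQuantile _ (by linarith) (by linarith)

end
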